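/- arXiv:1406.1384 — 2 statements merged into one kernel-verified Lean document; each statement's English description precedes it below -/
import Mathlib

section
/- (Reflection invariance of X_I.) For any multi-index I supported in Λ_-, the matrix X_I = ω^{|I|²/2} C_I ϑ(C_I) is reflection invariant; equivalently, ω^{|I|²/2} C_I ϑ(C_I) = ω^{−|I|²/2} ϑ(C_I) C_I. -/
open Matrix

/-- The primitive n-th root of unity `ω = exp(2πi/n)`. -/
noncomputable def pfOmega (n : ℕ) : ℂ := Complex.exp (2 * Real.pi * Complex.I / n)

/-- `ω^{m/2} = exp(πim/n)`, the canonical square root of `ω^m`. -/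
noncomputable def pfHalf (n : ℕ) (m : ℤ) : ℂ := Complex.exp (Real.pi * Complex.I * m / n)

/-- The ordered monomial `C_I = c 0 ^ I 0 * c 1 ^ I 1 * ⋯ * c (L-1) ^ I (L-1)`. -/
noncomputable def pfMonomial {L N : ℕ} (c : Fin L → Matrix (Fin N) (Fin N) ℂ)
    (I : Fin L → ℕ) : Matrix (Fin N) (Fin N) ℂ :=
  (List.ofFn fun j => c j ^ I j).prod

/-- `I ∘ I' = Σ_{j < j'} I j * I' j'`. -/
def pfCirc {k : ℕ} (I I' : Fin k → ℕ) : ℕ :=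
  ∑ j : Fin k, ∑ j' : Fin k, if j < j' then I j * I' j' else 0

/-- Total degree `|I| = Σ_j I j`. -/
def pfDeg {k : ℕ} (I : Fin k → ℕ) : ℕ := ∑ j, I j

/-- The complement multi-index `I^c = ((n - I j) mod n)_j`. -/
def pfComp (n : ℕ) {L : ℕ} (I : Fin L → ℕ) : Fin L → ℕ := fun j => (n - I j) % n

/-- The reflected multi-index `ϑI`, reversing the order of the entries. -/
def pfThetaIdx {L : ℕ} (I : Fin L → ℕ) : Fin L → ℕ := fun j => I j.rev

/-- The reflected monomial `ϑ(C_I) = ω^{-I∘I} C_{ϑ(I^c)}`. -/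
noncomputable def pfRefl (n : ℕ) {L N : ℕ} (c : Fin L → Matrix (Fin N) (Fin N) ℂ)
    (I : Fin L → ℕ) : Matrix (Fin N) (Fin N) ℂ :=
  pfOmega n ^ (-(pfCirc I I : ℤ)) • pfMonomial c (pfThetaIdx (pfComp n I))

/-- `c` is a family of parafermion generators of order `n`:
each `c j` is unitary, `c j ^ n = 1`, and `c j * c j' = ω • (c j' * c j)` for `j < j'`. -/
def IsParafermion (n : ℕ) {L N : ℕ} (c : Fin L → Matrix (Fin N) (Fin N) ℂ) : Prop :=
  (∀ j, (c j)ᴴ * c j = 1 ∧ c j * (c j)ᴴ = 1) ∧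
  (∀ j, c j ^ n = 1) ∧
  (∀ j j' : Fin L, j < j' → c j * c j' = pfOmega n • (c j' * c j))

/-- `I` is supported in `Λ₋ = {0, …, L/2 - 1}` (sites `1, …, L/2` in 1-based labels). -/
def pfSuppNeg {L : ℕ} (I : Fin L → ℕ) : Prop := ∀ j : Fin L, L / 2 ≤ j.val → I j = 0

/-- `I` is supported in `Λ₊ = {L/2, …, L-1}` (sites `L/2 + 1, …, L` in 1-based labels). -/
def pfSuppPos {L : ℕ} (I : Fin L → ℕ) : Prop := ∀ j : Fin L, j.val < L / 2 → I j = 0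

/-- The element `Σ_I a_I C_I` determined by a coefficient function `a`. -/
noncomputable def pfSum {L N : ℕ} (n : ℕ) (c : Fin L → Matrix (Fin N) (Fin N) ℂ)
    (a : (Fin L → Fin n) → ℂ) : Matrix (Fin N) (Fin N) ℂ :=
  ∑ I : Fin L → Fin n, a I • pfMonomial c fun j => (I j : ℕ)

/-- The reflection `ϑ(Σ_I a_I C_I) = Σ_I conj (a_I) ϑ(C_I)`. -/
noncomputable def pfSumRefl {L N : ℕ} (n : ℕ) (c : Fin L → Matrix (Fin N) (Fin N) ℂ)
    (a : (Fin L → Fin n) → ℂ) : Matrix (Fin N) (Fin N) ℂ :=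
  ∑ I : Fin L → Fin n, (starRingEnd ℂ) (a I) • pfRefl n c fun j => (I j : ℕ)

/-- Coefficients of an element of the observable algebra `𝔄₋ⁿ`: supported on
multi-indices supported in `Λ₋` with total degree divisible by `n`. -/
def pfObsNegCoeff {L : ℕ} (n : ℕ) (a : (Fin L → Fin n) → ℂ) : Prop :=
  ∀ I : Fin L → Fin n,
    ¬ (pfSuppNeg (fun j => (I j : ℕ)) ∧ n ∣ pfDeg (fun j => (I j : ℕ))) → a I = 0

/-- Coefficients of an element of the observable algebra `𝔄₊ⁿ`. -/
def pfObsPosCoeff {L : ℕ} (n : ℕ) (a : (Fin L → Fin n) → ℂ) : Prop :=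
  ∀ I : Fin L → Fin n,
    ¬ (pfSuppPos (fun j => (I j : ℕ)) ∧ n ∣ pfDeg (fun j => (I j : ℕ))) → a I = 0

/-- The cross-plane interaction
`H₀ = Σ_I (-1)^{|I|+1} ω^{|I|²/2} J_I C_I ϑ(C_I)` determined by couplings `J`. -/
noncomputable def pfH0 {L N : ℕ} (n : ℕ) (c : Fin L → Matrix (Fin N) (Fin N) ℂ)
    (J : (Fin L → Fin n) → ℝ) : Matrix (Fin N) (Fin N) ℂ :=
  ∑ I : Fin L → Fin n,
    ((-1 : ℂ) ^ (pfDeg (fun j => (I j : ℕ)) + 1) *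
        pfHalf n ((pfDeg (fun j => (I j : ℕ)) : ℤ) ^ 2) * (J I : ℂ)) •
      (pfMonomial c (fun j => (I j : ℕ)) * pfRefl n c fun j => (I j : ℕ))

theorem smul_commute_pow_right {R A : Type*} [CommSemiring R] [Semiring A] [Algebra R A]
    {x y : A} {w : R} (h : x * y = w • (y * x)) (b : ℕ) :
    x * y ^ b = w ^ b • (y ^ b * x) := by
  induction b with
  | zero => simp
  | succ b ih =>
    rw [pow_succ, ← mul_assoc, ih, smul_mul_assoc, mul_assoc, h, mul_smul_comm, smul_smul,
      ← pow_succ, mul_assoc]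

theorem smul_commute_pow_left {R A : Type*} [CommSemiring R] [Semiring A] [Algebra R A]
    {x y : A} {w : R} (h : x * y = w • (y * x)) (a : ℕ) :
    x ^ a * y = w ^ a • (y * x ^ a) := by
  induction a with
  | zero => simp
  | succ a ih =>
    rw [pow_succ, mul_assoc, h, mul_smul_comm, ← mul_assoc, ih, smul_mul_assoc, smul_smul,
      ← pow_succ', mul_assoc]

theorem smul_commute_prod_ofFn_right {R A : Type*} [CommSemiring R] [Semiring A] [Algebra R A]
    {k : ℕ} (f : Fin k → A) (x : A) (w : Fin k → R) (h : ∀ j, x * f j = w j • (f j * x)) :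
    x * (List.ofFn f).prod = (∏ j, w j) • ((List.ofFn f).prod * x) := by
  induction k with
  | zero => simp
  | succ k ih =>
    rw [List.ofFn_succ, List.prod_cons, Fin.prod_univ_succ, ← mul_assoc, h, smul_mul_assoc,
      mul_assoc, ih (fun j => f j.succ) (fun j => w j.succ) fun j => h j.succ, mul_smul_comm,
      smul_smul, mul_assoc]

theorem smul_commute_prod_ofFn_left {R A : Type*} [CommSemiring R] [Semiring A] [Algebra R A]
    {k : ℕ} (f : Fin k → A) (y : A) (w : Fin k → R) (h : ∀ j, f j * y = w j • (y * f j)) :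
    (List.ofFn f).prod * y = (∏ j, w j) • (y * (List.ofFn f).prod) := by
  induction k with
  | zero => simp
  | succ k ih =>
    rw [List.ofFn_succ, List.prod_cons, Fin.prod_univ_succ, mul_assoc,
      ih (fun j => f j.succ) (fun j => w j.succ) fun j => h j.succ, mul_smul_comm, ← mul_assoc,
      h, smul_mul_assoc, smul_smul, mul_assoc, mul_comm (w 0)]

/-- Monomials on separated sites commute up to the phase `ω^{|I||J|}`. -/
theorem pfMonomial_mul_pfMonomial {n L N : ℕ} {c : Fin L → Matrix (Fin N) (Fin N) ℂ}
    (hc : IsParafermion n c) {I J : Fin L → ℕ} (hI : pfSuppNeg I) (hJ : pfSuppPos J) :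
    pfMonomial c I * pfMonomial c J
      = pfOmega n ^ (pfDeg J * pfDeg I) • (pfMonomial c J * pfMonomial c I) := by
  have site : ∀ j j', c j ^ I j * c j' ^ J j'
      = (pfOmega n ^ I j) ^ J j' • (c j' ^ J j' * c j ^ I j) := by
    intro j j'
    by_cases hj : L / 2 ≤ j.val
    · simp [hI j hj]
    by_cases hj' : j'.val < L / 2
    · simp [hJ j' hj']
    have hlt : j < j' := by rw [Fin.lt_def]; omega
    exact smul_commute_pow_right (smul_commute_pow_left (hc.2.2 j j' hlt) _) _
  have row : ∀ j, c j ^ I j * pfMonomial c J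
      = (pfOmega n ^ pfDeg J) ^ I j • (pfMonomial c J * c j ^ I j) := by
    intro j
    have h := smul_commute_prod_ofFn_right _ _ _ (site j)
    rwa [Finset.prod_pow_eq_pow_sum, pow_right_comm] at h
  have h := smul_commute_prod_ofFn_left _ _ _ row
  rwa [Finset.prod_pow_eq_pow_sum, ← pow_mul] at h

theorem pfSuppPos_pfThetaIdx_pfComp {n L : ℕ} (hL : Even L) {I : Fin L → ℕ}
    (hI : pfSuppNeg I) : pfSuppPos (pfThetaIdx (pfComp n I)) := by
  intro j hj
  have h : I j.rev = 0 := hI _ (by obtain ⟨m, rfl⟩ := hL; rw [Fin.val_rev]; omega)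
  simp [pfThetaIdx, pfComp, h]

theorem pfOmega_pow_self {n : ℕ} (hn : n ≠ 0) : pfOmega n ^ n = 1 :=
  (Complex.isPrimitiveRoot_exp n hn).pow_eq_one

theorem pfOmega_pow_pfDeg_pfThetaIdx_pfComp {n L : ℕ} (hn : n ≠ 0) {I : Fin L → ℕ}
    (hI : ∀ j, I j < n) :
    pfOmega n ^ pfDeg (pfThetaIdx (pfComp n I)) * pfOmega n ^ pfDeg I = 1 := by
  have hdeg : pfDeg (pfThetaIdx (pfComp n I)) = ∑ j, pfComp n I j :=
    Equiv.sum_comp Fin.revPerm (pfComp n I)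
  rw [hdeg, pfDeg, ← pow_add, ← Finset.sum_add_distrib, ← Finset.prod_pow_eq_pow_sum]
  refine Finset.prod_eq_one fun j _ => ?_
  rw [pow_add, pfComp, ← pow_eq_pow_mod _ (pfOmega_pow_self hn), ← pow_add,
    Nat.sub_add_cancel (hI j).le, pfOmega_pow_self hn]

theorem pfHalf_eq_pfHalf_neg_mul (n : ℕ) (d : ℕ) :
    pfHalf n ((d : ℤ) ^ 2) = pfHalf n (-((d : ℤ) ^ 2)) * pfOmega n ^ (d * d) := by
  rw [pfHalf, pfHalf, pfOmega, ← Complex.exp_nat_mul, ← Complex.exp_add]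
  congr 1
  push_cast
  ring

/-- Reflection invariance of `X_I`:
`ω^{|I|²/2} C_I ϑ(C_I) = ω^{-|I|²/2} ϑ(C_I) C_I` for `I` supported in `Λ₋`. -/
theorem stmt_5 (n L N : ℕ) (hn : 2 ≤ n) (hL : 2 ≤ L) (hLeven : Even L) (hN : 1 ≤ N)
    (c : Fin L → Matrix (Fin N) (Fin N) ℂ) (hc : IsParafermion n c)
    (I : Fin L → ℕ) (hI : ∀ j, I j < n) (hm : pfSuppNeg I) :
    pfHalf n ((pfDeg I : ℤ) ^ 2) • (pfMonomial c I * pfRefl n c I)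
      = pfHalf n (-((pfDeg I : ℤ) ^ 2)) • (pfRefl n c I * pfMonomial c I) := by
  have h0 : n ≠ 0 := by omega
  have hinv := pfOmega_pow_pfDeg_pfThetaIdx_pfComp h0 hI
  have hphase : pfHalf n ((pfDeg I : ℤ) ^ 2)
      * pfOmega n ^ (pfDeg (pfThetaIdx (pfComp n I)) * pfDeg I)
        = pfHalf n (-((pfDeg I : ℤ) ^ 2)) := by
    rw [pfHalf_eq_pfHalf_neg_mul, mul_assoc, pow_mul, pow_mul, ← mul_pow, mul_comm (_ ^ pfDeg I),
      hinv, one_pow, mul_one]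
  rw [pfRefl, mul_smul_comm, smul_mul_assoc,
    pfMonomial_mul_pfMonomial hc hm (pfSuppPos_pfThetaIdx_pfComp hLeven hm),
    smul_comm (pfOmega n ^ (-(pfCirc I I : ℤ))), smul_smul, hphase]
end

section
/- (Conservation Law.) Let A, B_1, …, B_k ∈ 𝔄_-^n and let I^{(1)}, …, I^{(k)} be multi-indices supported in Λ_-. Set D = C_{I^{(1)}} B_1 C_{I^{(2)}} B_2 ⋯ C_{I^{(k)}} B_k and ϑ(D) = ϑ(C_{I^{(1)}}) ϑ(B_1) ⋯ ϑ(C_{I^{(k)}}) ϑ(B_k). If Σ_{j=1}^{k} |I^{(j)}| ≢ 0 mod n, then Tr(A D ϑ(A) ϑ(D)) = 0. -/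
open Matrix

section TwistedCommutation

variable {R : Type*} [Ring R] [Algebra ℂ R]

/-- `u` and `x` commute up to the scalar `z`: `u * x = z • (x * u)`. -/
def TwistedCommute (u : R) (z : ℂ) (x : R) : Prop := u * x = z • (x * u)

namespace TwistedCommute

variable {u v x y : R} {z w : ℂ}

lemma one_right (u : R) : TwistedCommute u 1 (1 : R) := by simp [TwistedCommute]

lemma mul_right (hx : TwistedCommute u z x) (hy : TwistedCommute u w y) :
    TwistedCommute u (z * w) (x * y) := by
  unfold TwistedCommute at *
  rw [← mul_assoc, hx, smul_mul_assoc, mul_assoc, hy, mul_smul_comm, smul_smul, mul_assoc]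

lemma mul_left (hu : TwistedCommute u z x) (hv : TwistedCommute v w x) :
    TwistedCommute (u * v) (z * w) x := by
  unfold TwistedCommute at *
  rw [mul_assoc, hv, mul_smul_comm, ← mul_assoc, hu, smul_mul_assoc, smul_smul, mul_assoc,
    mul_comm w]

lemma pow_right (hx : TwistedCommute u z x) (m : ℕ) : TwistedCommute u (z ^ m) (x ^ m) := by
  induction m with
  | zero => simpa using one_right u
  | succ m ih => simpa only [pow_succ] using ih.mul_right hx

lemma smul_right (hx : TwistedCommute u z x) (r : ℂ) : TwistedCommute u z (r • x) := by
  unfold TwistedCommute at *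
  rw [mul_smul_comm, hx, smul_mul_assoc, smul_comm]

lemma sum_right {ι : Type*} (s : Finset ι) {f : ι → R}
    (h : ∀ i ∈ s, TwistedCommute u z (f i)) : TwistedCommute u z (∑ i ∈ s, f i) := by
  unfold TwistedCommute at *
  rw [Finset.mul_sum, Finset.sum_mul, Finset.smul_sum]
  exact Finset.sum_congr rfl h

lemma prod_ofFn_right {m : ℕ} {f : Fin m → R} {g : Fin m → ℂ}
    (h : ∀ i, TwistedCommute u (g i) (f i)) :
    TwistedCommute u (∏ i, g i) (List.ofFn f).prod := by
  induction m with
  | zero => simpa using one_right u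
  | succ m ih =>
    rw [List.ofFn_succ, List.prod_cons, Fin.prod_univ_succ]
    exact (h 0).mul_right (ih fun i => h i.succ)

lemma units_inv {u : Rˣ} (hu : TwistedCommute (u : R) z x) (hz : z ≠ 0) :
    TwistedCommute (↑u⁻¹ : R) z⁻¹ x := by
  unfold TwistedCommute at *
  have h : x * u = z⁻¹ • (u * x) := by rw [hu, smul_smul, inv_mul_cancel₀ hz, one_smul]
  calc (↑u⁻¹ : R) * x = ↑u⁻¹ * (x * u) * ↑u⁻¹ := by simp [mul_assoc]
    _ = z⁻¹ • (x * ↑u⁻¹) := by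
      rw [h, mul_smul_comm, smul_mul_assoc, Units.inv_mul_cancel_left]

lemma trace_eq_zero {N : ℕ} {u : (Matrix (Fin N) (Fin N) ℂ)ˣ} {x : Matrix (Fin N) (Fin N) ℂ}
    (h : TwistedCommute (u : Matrix (Fin N) (Fin N) ℂ) z x) (hz : z ≠ 1) : x.trace = 0 := by
  unfold TwistedCommute at h
  have h1 : z * x.trace = x.trace := by
    calc z * x.trace = ((z • (x * u)) * (↑u⁻¹ : Matrix (Fin N) (Fin N) ℂ)).trace := by
          simp [mul_assoc]
      _ = x.trace := by
          rw [← h, Matrix.trace_mul_comm, Units.inv_mul_cancel_left]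
  by_contra hx
  exact hz (mul_right_cancel₀ hx (by rw [h1, one_mul]))

end TwistedCommute

end TwistedCommutation

lemma isPrimitiveRoot_pfOmega {n : ℕ} (hn : n ≠ 0) : IsPrimitiveRoot (pfOmega n) n :=
  Complex.isPrimitiveRoot_exp n hn

lemma pfOmega_ne_zero (n : ℕ) : pfOmega n ≠ 0 := Complex.exp_ne_zero _

/-- The alternating product of the first `m` generators and their inverses rescales the generators
on exactly one side of the cut at `m`, by `ω⁻¹`; the side depends on the parity of `m`. -/
lemma IsParafermion.exists_unit_twistedCommute {n L N : ℕ}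
    {c : Fin L → Matrix (Fin N) (Fin N) ℂ} (hc : IsParafermion n c) (m : ℕ) (hm : m ≤ L) :
    ∃ u : (Matrix (Fin N) (Fin N) ℂ)ˣ, ∀ j : Fin L,
      TwistedCommute (u : Matrix (Fin N) (Fin N) ℂ)
        (if j.val < m then (if Even m then (pfOmega n)⁻¹ else 1)
          else (if Even m then 1 else (pfOmega n)⁻¹)) (c j) := by
  have h0 := pfOmega_ne_zero n
  induction m with
  | zero => exact ⟨1, fun j => by simp [TwistedCommute]⟩
  | succ m ih =>
    obtain ⟨u, hu⟩ := ih (by omega)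
    let i : Fin L := ⟨m, hm⟩
    let v : (Matrix (Fin N) (Fin N) ℂ)ˣ := ⟨c i, (c i)ᴴ, (hc.1 i).2, (hc.1 i).1⟩
    have hlt : ∀ j : Fin L, j.val < m →
        TwistedCommute (v : Matrix (Fin N) (Fin N) ℂ) (pfOmega n)⁻¹ (c j) := by
      intro j hj
      change c i * c j = _ • (c j * c i)
      rw [hc.2.2 j i hj, smul_smul, inv_mul_cancel₀ h0, one_smul]
    have heq : ∀ j : Fin L, j.val = m →
        TwistedCommute (v : Matrix (Fin N) (Fin N) ℂ) 1 (c j) := by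
      intro j hj
      obtain rfl : j = i := Fin.ext hj
      change c i * c i = (1 : ℂ) • (c i * c i)
      rw [one_smul]
    have hgt : ∀ j : Fin L, m < j.val →
        TwistedCommute (v : Matrix (Fin N) (Fin N) ℂ) (pfOmega n) (c j) :=
      fun j hj => hc.2.2 i j hj
    by_cases hpar : Even m
    · refine ⟨u * v⁻¹, fun j => ?_⟩
      have hpar' : ¬ Even (m + 1) := by simpa [Nat.even_add_one] using hpar
      have huj := hu j
      rw [Units.val_mul]
      simp only [hpar, hpar', if_true, if_false] at huj ⊢
      rcases lt_trichotomy j.val m with hj | hj | hj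
      · have := huj.mul_left ((hlt j hj).units_inv (inv_ne_zero h0))
        simpa [hj, hj.trans (Nat.lt_succ_self m), h0] using this
      · have := huj.mul_left ((heq j hj).units_inv one_ne_zero)
        simpa [hj] using this
      · have := huj.mul_left ((hgt j hj).units_inv h0)
        simpa [hj.not_gt, show ¬ j.val < m + 1 by omega] using this
    · refine ⟨u * v, fun j => ?_⟩
      have hpar' : Even (m + 1) := by simpa [Nat.even_add_one] using hpar
      have huj := hu j
      rw [Units.val_mul]
      simp only [hpar, hpar', if_true, if_false] at huj ⊢
      rcases lt_trichotomy j.val m with hj | hj | hj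
      · have := huj.mul_left (hlt j hj)
        simpa [hj, hj.trans (Nat.lt_succ_self m)] using this
      · have := huj.mul_left (heq j hj)
        simpa [hj] using this
      · have := huj.mul_left (hgt j hj)
        simpa [hj.not_gt, show ¬ j.val < m + 1 by omega, h0] using this

section GradedOperators

variable {n L N : ℕ} {c : Fin L → Matrix (Fin N) (Fin N) ℂ} {u : Matrix (Fin N) (Fin N) ℂ}
  {p q : ℂ}

lemma twistedCommute_pfMonomial
    (hu : ∀ j : Fin L, TwistedCommute u (if j.val < L / 2 then p else q) (c j))
    {I : Fin L → ℕ} (hI : pfSuppNeg I) : TwistedCommute u (p ^ pfDeg I) (pfMonomial c I) := by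
  have h := TwistedCommute.prod_ofFn_right fun j => (hu j).pow_right (I j)
  rw [pfMonomial]
  convert h using 1
  rw [pfDeg, ← Finset.prod_pow_eq_pow_sum]
  refine Finset.prod_congr rfl fun j _ => ?_
  split_ifs with hj
  · rfl
  · rw [hI j (not_lt.mp hj), pow_zero, pow_zero]

lemma twistedCommute_pfRefl (hL : Even L) (hq : q ^ n = 1)
    (hu : ∀ j : Fin L, TwistedCommute u (if j.val < L / 2 then p else q) (c j))
    {I : Fin L → ℕ} (hI : pfSuppNeg I) (hIn : ∀ j, I j < n) :
    TwistedCommute u (q⁻¹ ^ pfDeg I) (pfRefl n c I) := by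
  have h := TwistedCommute.prod_ofFn_right fun j =>
    (hu j).pow_right (pfThetaIdx (pfComp n I) j)
  refine TwistedCommute.smul_right ?_ _
  rw [pfMonomial]
  convert h using 1
  rw [pfDeg, ← Finset.prod_pow_eq_pow_sum, ← Equiv.prod_comp Fin.revPerm]
  refine Finset.prod_congr rfl fun j _ => ?_
  have hjn := hIn j.rev
  simp only [Fin.revPerm_apply, pfThetaIdx, pfComp]
  rcases Nat.eq_zero_or_pos (I j.rev) with h0 | hpos
  · simp [h0]
  · have hj : ¬ j.val < L / 2 := fun hj => by
      have hrev := hI j.rev (by rw [Fin.val_rev]; obtain ⟨r, rfl⟩ := hL; omega)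
      omega
    have hq0 : q ≠ 0 := by
      rintro rfl
      rw [zero_pow (by omega)] at hq
      exact zero_ne_one hq
    rw [if_neg hj, Nat.mod_eq_of_lt (by omega), inv_pow]
    refine inv_eq_of_mul_eq_one_left ?_
    rw [← pow_add, Nat.sub_add_cancel hjn.le, hq]

lemma twistedCommute_pfSum (hp : p ^ n = 1)
    (hu : ∀ j : Fin L, TwistedCommute u (if j.val < L / 2 then p else q) (c j))
    {a : (Fin L → Fin n) → ℂ} (ha : pfObsNegCoeff n a) : TwistedCommute u 1 (pfSum n c a) := by
  refine TwistedCommute.sum_right _ fun I _ => ?_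
  by_cases hI : pfSuppNeg (fun j => (I j : ℕ)) ∧ n ∣ pfDeg (fun j => (I j : ℕ))
  · have h := twistedCommute_pfMonomial hu hI.1
    obtain ⟨d, hd⟩ := hI.2
    rw [hd, pow_mul, hp, one_pow] at h
    exact h.smul_right _
  · simp [ha I hI, TwistedCommute]

lemma twistedCommute_pfSumRefl (hL : Even L) (hq : q ^ n = 1)
    (hu : ∀ j : Fin L, TwistedCommute u (if j.val < L / 2 then p else q) (c j))
    {a : (Fin L → Fin n) → ℂ} (ha : pfObsNegCoeff n a) :
    TwistedCommute u 1 (pfSumRefl n c a) := by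
  refine TwistedCommute.sum_right _ fun I _ => ?_
  by_cases hI : pfSuppNeg (fun j => (I j : ℕ)) ∧ n ∣ pfDeg (fun j => (I j : ℕ))
  · have h := twistedCommute_pfRefl hL hq hu hI.1 fun j => (I j).isLt
    obtain ⟨d, hd⟩ := hI.2
    rw [hd, pow_mul, inv_pow, hq, inv_one, one_pow] at h
    exact h.smul_right _
  · simp [ha I hI, TwistedCommute]

end GradedOperators


/-- Conservation Law: with `D = Π_i (C_{I⁽ⁱ⁾} B_i)` and
`ϑ(D) = Π_i (ϑ(C_{I⁽ⁱ⁾}) ϑ(B_i))` for `A, B_i ∈ 𝔄₋ⁿ` and `I⁽ⁱ⁾` supported in `Λ₋`,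
if `Σ_i |I⁽ⁱ⁾| ≢ 0 mod n`, then `Tr (A D ϑ(A) ϑ(D)) = 0`. -/
theorem stmt_15 (n L N : ℕ) (hn : 2 ≤ n) (hL : 2 ≤ L) (hLeven : Even L) (hN : 1 ≤ N)
    (c : Fin L → Matrix (Fin N) (Fin N) ℂ) (hc : IsParafermion n c)
    (k : ℕ) (Idx : Fin k → Fin L → ℕ)
    (hIdx : ∀ i j, Idx i j < n) (hIsupp : ∀ i, pfSuppNeg (Idx i))
    (a : (Fin L → Fin n) → ℂ) (ha : pfObsNegCoeff n a)
    (b : Fin k → (Fin L → Fin n) → ℂ) (hb : ∀ i, pfObsNegCoeff n (b i))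
    (hdeg : ¬ (n ∣ ∑ i : Fin k, pfDeg (Idx i))) :
    let A := pfSum n c a
    let θA := pfSumRefl n c a
    let D := (List.ofFn fun i : Fin k => pfMonomial c (Idx i) * pfSum n c (b i)).prod
    let θD := (List.ofFn fun i : Fin k => pfRefl n c (Idx i) * pfSumRefl n c (b i)).prod
    Matrix.trace (A * D * (θA * θD)) = 0 := by
  intro A θA D θD
  have hω := isPrimitiveRoot_pfOmega (n := n) (by omega)
  obtain ⟨u, hu⟩ := hc.exists_unit_twistedCommute (L / 2) (by omega)
  set p : ℂ := if Even (L / 2) then (pfOmega n)⁻¹ else 1 with hp_def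
  set q : ℂ := if Even (L / 2) then 1 else (pfOmega n)⁻¹ with hq_def
  have hp : p ^ n = 1 := by rw [hp_def]; split_ifs <;> simp [hω.pow_eq_one]
  have hq : q ^ n = 1 := by rw [hq_def]; split_ifs <;> simp [hω.pow_eq_one]
  have hD := TwistedCommute.prod_ofFn_right fun i =>
    (twistedCommute_pfMonomial hu (hIsupp i)).mul_right (twistedCommute_pfSum hp hu (hb i))
  have hθD := TwistedCommute.prod_ofFn_right fun i =>
    (twistedCommute_pfRefl hLeven hq hu (hIsupp i) (hIdx i)).mul_right
      (twistedCommute_pfSumRefl hLeven hq hu (hb i))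
  refine (((twistedCommute_pfSum hp hu ha).mul_right hD).mul_right
    ((twistedCommute_pfSumRefl hLeven hq hu ha).mul_right hθD)).trace_eq_zero ?_
  simp only [mul_one, one_mul, Finset.prod_pow_eq_pow_sum]
  have hne := mt (hω.pow_eq_one_iff_dvd _).mp hdeg
  rw [hp_def, hq_def]
  split_ifs <;> simpa using hne
end
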